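/- Let L be a commutative incline, i.e., L carries a SemilatticeSup structure and a CommSemigroup multiplication satisfying x*(y ⊔ z) = x*y ⊔ x*z and x ⊔ x*y = x for all x, y, z ∈ L. For a matrix A : Fin 3 → Fin 3 → L and m ≥ 1, define the m-th power entrywise by (A^m)_{ij} = the supremum, over all walks V : Fin (m+1) → Fin 3 with V 0 = i and V m = j, of the products ∏_{s=0}^{m-1} A (V s) (V (s+1)) (a finite nonempty supremum in the semilattice). Then A^{11} ≤ A^5 entrywise, i.e., for all i j : Fin 3, (A^{11})_{ij} ≤ (A^5)_{ij}. -/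

import Mathlib

/-- The product of the entries of a matrix `A` along a walk of positive length `l + 1`
on `Fin n` (a walk of length `l + 1` being a function `Fin (l + 2) → Fin n`). -/
def walkProd {L : Type*} [Mul L] {n : ℕ} (A : Fin n → Fin n → L) :
    {l : ℕ} → (Fin (l + 2) → Fin n) → L
  | 0, V => A (V 0) (V 1)
  | l + 1, V => A (V 0) (V 1) * walkProd A (fun t : Fin (l + 2) => V t.succ)

/-- The `(i, j)` entry of the `(m + 1)`-st power of the matrix `A` over a semilattice:
the (finite, nonempty) supremum, over all walks `V` of length `m + 1` on `Fin 3`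
with `V 0 = i` and `V (m + 1) = j`, of the product of the entries of `A` along `V`. -/
def powEntry {L : Type*} [SemilatticeSup L] [Mul L]
    (A : Fin 3 → Fin 3 → L) (m : ℕ) (i j : Fin 3) : L :=
  Finset.sup'
    (Finset.univ.filter fun V : Fin (m + 2) → Fin 3 => V 0 = i ∧ V (Fin.last (m + 1)) = j)
    ⟨fun t => if t = 0 then i else j, by
      simp only [Finset.mem_filter, Finset.mem_univ, true_and]
      constructor
      · simp
      · rw [if_neg (by simp [Fin.ext_iff])]⟩
    (fun V => walkProd A V)

/-- `HasWalkEdges k i j s` says that `s` is the multiset of edges of some walk of length `k`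
from `i` to `j`. -/
inductive HasWalkEdges {α : Type*} : ℕ → α → α → Multiset (α × α) → Prop
  | nil (i : α) : HasWalkEdges 0 i i 0
  | cons {k : ℕ} (a : α) {b j : α} {s : Multiset (α × α)} (h : HasWalkEdges k b j s) :
      HasWalkEdges (k + 1) a j ((a, b) ::ₘ s)

theorem HasWalkEdges.append {α : Type*} {k l : ℕ} {a b c : α} {s t : Multiset (α × α)}
    (hs : HasWalkEdges k a b s) (ht : HasWalkEdges l b c t) :
    HasWalkEdges (k + l) a c (s + t) := by
  induction hs with
  | nil i => simpa using ht
  | cons a h ih =>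
    rw [Nat.add_right_comm, Multiset.cons_add]
    exact .cons a (ih ht)

theorem HasWalkEdges.map {α β : Type*} (f : α → β) {k : ℕ} {i j : α} {s : Multiset (α × α)}
    (h : HasWalkEdges k i j s) :
    HasWalkEdges k (f i) (f j) (s.map (Prod.map f f)) := by
  induction h with
  | nil i => exact .nil _
  | cons a h ih =>
    rw [Multiset.map_cons]
    exact .cons _ ih

theorem exists_hasWalkEdges {L : Type*} [CommSemigroup L] {n : ℕ} (A : Fin n → Fin n → L)
    {l : ℕ} (V : Fin (l + 2) → Fin n) :
    ∃ s, HasWalkEdges (l + 1) (V 0) (V (Fin.last (l + 1))) s ∧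
      ((walkProd A V : L) : WithOne L) = (s.map fun e => (A e.1 e.2 : WithOne L)).prod := by
  induction l with
  | zero => exact ⟨_, .cons _ (.nil _), by simp [walkProd]⟩
  | succ l ih =>
    obtain ⟨s, hs, hprod⟩ := ih fun t => V t.succ
    refine ⟨_, .cons (V 0) hs, ?_⟩
    rw [walkProd, WithOne.coe_mul, hprod]
    simp

theorem exists_walk_of_hasWalkEdges {L : Type*} [CommSemigroup L] {n : ℕ}
    (A : Fin n → Fin n → L) {l : ℕ} {i j : Fin n} {s : Multiset (Fin n × Fin n)}
    (h : HasWalkEdges (l + 1) i j s) :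
    ∃ V : Fin (l + 2) → Fin n, V 0 = i ∧ V (Fin.last (l + 1)) = j ∧
      ((walkProd A V : L) : WithOne L) = (s.map fun e => (A e.1 e.2 : WithOne L)).prod := by
  induction l generalizing i s with
  | zero =>
    cases h with
    | cons _ h =>
      cases h
      exact ⟨![i, j], rfl, rfl, by simp [walkProd]⟩
  | succ l ih =>
    cases h with
    | cons _ h =>
      obtain ⟨V, rfl, hV1, hprod⟩ := ih h
      refine ⟨Fin.cons i V, rfl, hV1, ?_⟩
      rw [walkProd, WithOne.coe_mul]
      simp only [Fin.cons_succ, hprod]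
      simp

theorem le_of_coe_dvd_coe {L : Type*} [SemilatticeSup L] [CommSemigroup L]
    (habs : ∀ x y : L, x ⊔ x * y = x) {a b : L} (h : (a : WithOne L) ∣ (b : WithOne L)) :
    b ≤ a := by
  obtain ⟨c, hc⟩ := h
  cases c with
  | one => exact (WithOne.coe_inj.1 (by simpa using hc)).le
  | coe c =>
    obtain rfl : b = a * c := WithOne.coe_inj.1 (by simpa using hc)
    exact sup_eq_left.1 (habs a c)

/-- Search for a walk of length `k` from `i` to `j` using only edges of the list `E`, each at most
as often as it occurs in `E`. -/
def existsWalkWithin : ℕ → Fin 3 → Fin 3 → List (Fin 3 × Fin 3) → Bool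
  | 0, i, j, _ => i == j
  | k + 1, i, j, E =>
    [0, 1, 2].any fun x => E.contains (i, x) && existsWalkWithin k x j (E.erase (i, x))

theorem exists_le_of_existsWalkWithin {k : ℕ} {i j : Fin 3} {E : List (Fin 3 × Fin 3)}
    (h : existsWalkWithin k i j E = true) :
    ∃ s ≤ (E : Multiset (Fin 3 × Fin 3)), HasWalkEdges k i j s := by
  induction k generalizing i E with
  | zero =>
    obtain rfl : i = j := by simpa [existsWalkWithin] using h
    exact ⟨0, Multiset.zero_le _, .nil i⟩
  | succ k ih =>
    obtain ⟨x, -, hx⟩ := List.any_eq_true.1 h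
    obtain ⟨hmem, hx⟩ := Bool.and_eq_true_iff.1 hx
    obtain ⟨s, hs, hw⟩ := ih hx
    refine ⟨_, ?_, .cons i hw⟩
    rw [Multiset.coe_eq_coe.2 (List.perm_cons_erase (List.contains_iff_mem.1 hmem))]
    exact Multiset.cons_le_cons _ hs

/-- Check that each extension by at most `f` steps of a walk of length `k` from `i` to `j` with
list of edges `E` reaches a walk whose edges contain those of a walk shorter by six with the same
endpoints. -/
def everyExtensionShortens : ℕ → ℕ → Fin 3 → Fin 3 → List (Fin 3 × Fin 3) → Bool
  | 0, k, i, j, E => Nat.ble 6 k && existsWalkWithin (k - 6) i j E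
  | f + 1, k, i, j, E => (Nat.ble 6 k && existsWalkWithin (k - 6) i j E) ||
    [0, 1, 2].all fun x => everyExtensionShortens f (k + 1) i x ((j, x) :: E)

theorem exists_shorter_walk_of_prefix {k l : ℕ} {i j t : Fin 3} {E : List (Fin 3 × Fin 3)}
    {s : Multiset (Fin 3 × Fin 3)}
    (h : (Nat.ble 6 k && existsWalkWithin (k - 6) i j E) = true) (hs : HasWalkEdges l j t s) :
    ∃ m, m + 6 = k + l ∧ ∃ s' ≤ (E : Multiset (Fin 3 × Fin 3)) + s, HasWalkEdges m i t s' := by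
  obtain ⟨hk, h⟩ := Bool.and_eq_true_iff.1 h
  have hk := Nat.le_of_ble_eq_true hk
  obtain ⟨s', hs', hw⟩ := exists_le_of_existsWalkWithin h
  exact ⟨k - 6 + l, by lia, s' + s, by gcongr, hw.append hs⟩

theorem exists_shorter_walk {f k : ℕ} {i j t : Fin 3} {E : List (Fin 3 × Fin 3)}
    {s : Multiset (Fin 3 × Fin 3)}
    (h : everyExtensionShortens f k i j E = true) (hs : HasWalkEdges f j t s) :
    ∃ m, m + 6 = k + f ∧ ∃ s' ≤ (E : Multiset (Fin 3 × Fin 3)) + s, HasWalkEdges m i t s' := by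
  induction f generalizing k j E s with
  | zero => exact exists_shorter_walk_of_prefix h hs
  | succ f ih =>
    rcases Bool.or_eq_true_iff.1 h with h | h
    · exact exists_shorter_walk_of_prefix h hs
    · cases hs with
      | @cons _ _ x _ s hs =>
        obtain ⟨m, hm, s', hs', hw⟩ :=
          ih (List.all_eq_true.1 h x (by fin_cases x <;> simp)) hs
        refine ⟨m, by lia, s', ?_, hw⟩
        rwa [← Multiset.cons_coe, Multiset.cons_add, ← Multiset.add_cons] at hs'

theorem exists_walk_five_of_walk_eleven {i j : Fin 3} {s : Multiset (Fin 3 × Fin 3)}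
    (hs : HasWalkEdges 11 i j s) : ∃ s' ≤ s, HasWalkEdges 5 i j s' := by
  have hcheck : everyExtensionShortens 11 0 0 0 [] = true := by decide +kernel
  have hσ (x : Fin 3) : Equiv.swap i 0 (Equiv.swap i 0 x) = x :=
    Equiv.congr_fun (Equiv.swap_swap i 0) x
  have hs₀ := hs.map (Equiv.swap i 0)
  rw [Equiv.swap_apply_left] at hs₀
  obtain ⟨m, hm, s', hs', hw⟩ := exists_shorter_walk hcheck hs₀
  obtain rfl : m = 5 := by lia
  refine ⟨s'.map (Prod.map (Equiv.swap i 0) (Equiv.swap i 0)), ?_, ?_⟩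
  · simpa [Prod.map, hσ] using
      Multiset.map_le_map (f := Prod.map (Equiv.swap i 0) (Equiv.swap i 0)) hs'
  · simpa [hσ j] using hw.map (Equiv.swap i 0)

/-- For every `3 × 3` matrix over a commutative incline, `A^11 ≤ A^5`
entrywise (note `A^11 = powEntry A 10` and `A^5 = powEntry A 4`). -/
theorem pow_eleven_le_pow_five
    {L : Type*} [SemilatticeSup L] [CommSemigroup L]
    (hdist : ∀ x y z : L, x * (y ⊔ z) = x * y ⊔ x * z)
    (habs : ∀ x y : L, x ⊔ x * y = x)
    (A : Fin 3 → Fin 3 → L) :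
    ∀ i j : Fin 3, powEntry A 10 i j ≤ powEntry A 4 i j := by
  intro i j
  refine Finset.sup'_le _ _ fun V hV => ?_
  obtain ⟨rfl, rfl⟩ : V 0 = i ∧ V (Fin.last 11) = j := by simpa using hV
  obtain ⟨s, hs, hVs⟩ := exists_hasWalkEdges A V
  obtain ⟨s', hs', hw⟩ := exists_walk_five_of_walk_eleven hs
  obtain ⟨W, hW0, hW1, hWs⟩ := exists_walk_of_hasWalkEdges A hw
  have hdvd : ((walkProd A W : L) : WithOne L) ∣ ((walkProd A V : L) : WithOne L) := by
    rw [hVs, hWs]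
    exact Multiset.prod_dvd_prod_of_le (Multiset.map_le_map hs')
  calc walkProd A V ≤ walkProd A W := le_of_coe_dvd_coe habs hdvd
    _ ≤ powEntry A 4 (V 0) (V (Fin.last 11)) :=
      Finset.le_sup' (walkProd A) (Finset.mem_filter.2 ⟨Finset.mem_univ W, hW0, hW1⟩)
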